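/- arXiv:1907.02033 — 5 statements merged into one kernel-verified Lean document; each statement's English description precedes it below -/
import Mathlib

section
/- Fix z ∈ ℝ with z ≠ 0. The function p ↦ J(p,z) := −z·p·e^{−z} + (1 − p·e^{−z})·ln((1 − p·e^{−z})/(1−p)) is strictly convex on the open interval (0, min(1, e^{z})). -/
/-- The centered rate function `J_p(z)` (as a function of the tail probability `p`
and `z`), with the convention `0 * log 0 = 0` (automatic since `Real.log 0 = 0`). -/
noncomputable def Jfun (p z : ℝ) : ℝ :=
  -z * p * Real.exp (-z) +
    (1 - p * Real.exp (-z)) * Real.log ((1 - p * Real.exp (-z)) / (1 - p))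

/-- The first derivative of the rate function with respect to `p`. -/
theorem hasDerivAt_Jfun {p z : ℝ} (hu : 0 < 1 - p * Real.exp (-z)) (hv : 0 < 1 - p) :
    HasDerivAt (fun p => Jfun p z)
      (-z * Real.exp (-z) - Real.exp (-z) * Real.log ((1 - p * Real.exp (-z)) / (1 - p))
        - Real.exp (-z) + (1 - p * Real.exp (-z)) / (1 - p)) p := by
  unfold Jfun
  generalize Real.exp (-z) = c at *
  have hu' : HasDerivAt (fun p : ℝ => 1 - p * c) (-c) p := by
    simpa using ((hasDerivAt_id p).mul_const c).const_sub 1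
  have hv' : HasDerivAt (fun p : ℝ => 1 - p) (-1) p := (hasDerivAt_id p).const_sub 1
  have hl : HasDerivAt (fun p : ℝ => -z * p * c) (-z * c) p := by
    simpa using ((hasDerivAt_id p).const_mul (-z)).mul_const c
  refine (hl.add (hu'.mul ((hu'.div hv' hv.ne').log (div_pos hu hv).ne'))).congr_deriv ?_
  simp only [Pi.div_apply]
  have hu_ne : 1 - c * p ≠ 0 := by rw [mul_comm]; exact hu.ne'
  field_simp
  ring

/-- The second derivative of the rate function with respect to `p`. -/
theorem hasDerivAt_deriv_Jfun {p z : ℝ} (hu : 0 < 1 - p * Real.exp (-z)) (hv : 0 < 1 - p) :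
    HasDerivAt
      (fun p => -z * Real.exp (-z)
        - Real.exp (-z) * Real.log ((1 - p * Real.exp (-z)) / (1 - p))
        - Real.exp (-z) + (1 - p * Real.exp (-z)) / (1 - p))
      ((1 - Real.exp (-z)) ^ 2 / ((1 - p * Real.exp (-z)) * (1 - p) ^ 2)) p := by
  generalize Real.exp (-z) = c at *
  have hu' : HasDerivAt (fun p : ℝ => 1 - p * c) (-c) p := by
    simpa using ((hasDerivAt_id p).mul_const c).const_sub 1
  have hv' : HasDerivAt (fun p : ℝ => 1 - p) (-1) p := (hasDerivAt_id p).const_sub 1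
  have hq := hu'.div hv' hv.ne'
  refine (((((hq.log (div_pos hu hv).ne').const_mul c).const_sub (-z * c)).sub_const c).add
    hq).congr_deriv ?_
  simp only [Pi.div_apply]
  have hu_ne : 1 - c * p ≠ 0 := by rw [mul_comm]; exact hu.ne'
  field_simp
  ring

theorem stmt9 (z : ℝ) (hz : z ≠ 0) :
    StrictConvexOn ℝ (Set.Ioo (0:ℝ) (min 1 (Real.exp z))) (fun p => Jfun p z) := by
  have hpos : ∀ p ∈ Set.Ioo (0:ℝ) (min 1 (Real.exp z)),
      0 < 1 - p * Real.exp (-z) ∧ 0 < 1 - p := by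
    intro p hp
    obtain ⟨hp1, hpz⟩ := lt_min_iff.mp hp.2
    refine ⟨?_, sub_pos.mpr hp1⟩
    rw [sub_pos, Real.exp_neg, ← div_eq_mul_inv, div_lt_one (Real.exp_pos z)]
    exact hpz
  have hc : 1 - Real.exp (-z) ≠ 0 := by
    rw [sub_ne_zero, ne_comm, Ne, Real.exp_eq_one_iff, neg_eq_zero]
    exact hz
  refine strictConvexOn_of_deriv2_pos (convex_Ioo _ _) (fun p hp =>
    (hasDerivAt_Jfun (hpos p hp).1 (hpos p hp).2).continuousAt.continuousWithinAt) ?_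
  intro p hp
  rw [interior_Ioo] at hp
  obtain ⟨hu, hv⟩ := hpos p hp
  have hderiv := Filter.eventuallyEq_of_mem (isOpen_Ioo.mem_nhds hp) fun q hq =>
    (hasDerivAt_Jfun (hpos q hq).1 (hpos q hq).2).deriv
  rw [Function.iterate_succ_apply, Function.iterate_one, hderiv.deriv_eq,
    (hasDerivAt_deriv_Jfun hu hv).deriv]
  positivity
end

section
/- Fix z ∈ ℝ. The function p ↦ J(p,z) := −z·p·e^{−z} + (1 − p·e^{−z})·ln((1 − p·e^{−z})/(1−p)), extended to p = 0 by J(0,z) = 0, has right derivative at p = 0 equal to e^{−z}·(−z − 1) + 1; moreover this value is strictly positive whenever z ≠ 0. -/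
theorem stmt10 (z : ℝ) :
    HasDerivWithinAt (fun p => Jfun p z) (Real.exp (-z) * (-z - 1) + 1) (Set.Ici 0) 0 ∧
      (z ≠ 0 → 0 < Real.exp (-z) * (-z - 1) + 1) := by
  refine ⟨HasDerivAt.hasDerivWithinAt ?_, fun hz => ?_⟩
  · have hlin : HasDerivAt (fun p : ℝ => -z * p * Real.exp (-z)) (-z * 1 * Real.exp (-z)) 0 :=
      ((hasDerivAt_id' (0 : ℝ)).const_mul (-z)).mul_const _
    have hnum : HasDerivAt (fun p : ℝ => 1 - p * Real.exp (-z)) (-(1 * Real.exp (-z))) 0 :=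
      ((hasDerivAt_id' (0 : ℝ)).mul_const _).const_sub 1
    have hden : HasDerivAt (fun p : ℝ => 1 - p) (-1) 0 :=
      (hasDerivAt_id' (0 : ℝ)).const_sub 1
    have hlog := (hnum.fun_div hden (by norm_num)).log (by norm_num)
    refine (hlin.fun_add (hnum.fun_mul hlog)).congr_deriv ?_
    norm_num
    ring
  · have hlt : Real.exp (-z) * (z + 1) < Real.exp (-z) * Real.exp z :=
      mul_lt_mul_of_pos_left (Real.add_one_lt_exp hz) (Real.exp_pos _)
    rw [← Real.exp_add, neg_add_cancel, Real.exp_zero] at hlt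
    linarith
end

section
/- For every p ∈ (0,1) and every z ∈ ℝ with p·e^{−z} < 1, the centered rate function admits the series representation J(p,z) = p·e^{−z}·[ −z + ln((1−p)/e) + Σ_{k=2}^{∞} (p·e^{−z})^{k−1}/(k² − k) ] − ln(1−p), the series being absolutely convergent. -/
theorem hasSum_pow_div_mul_pred {x : ℝ} (hx0 : x ≠ 0) (hx : |x| < 1) :
    HasSum (fun k : ℕ => x ^ (k + 1) / (((k : ℝ) + 2) ^ 2 - ((k : ℝ) + 2)))
      (((1 - x) * Real.log (1 - x) + x) / x) := by
  have h₁ := Real.hasSum_pow_div_log_of_abs_lt_one hx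
  have h₂ := (hasSum_nat_add_iff' 1).mpr h₁
  convert! h₁.sub (h₂.div_const x) using 1
  · funext k
    have hk₁ : (k : ℝ) + 1 ≠ 0 := by positivity
    have hk₂ : (k : ℝ) + 2 ≠ 0 := by positivity
    have hsq : ((k : ℝ) + 2) ^ 2 - ((k : ℝ) + 2) = (k + 1) * (k + 2) := by ring
    have hcast : (k : ℝ) + 1 + 1 = k + 2 := by ring
    push_cast
    rw [hsq, hcast]
    field_simp
    ring
  · simp only [Finset.sum_range_one]
    field_simp
    norm_num
    ring

theorem stmt13 (p z : ℝ) (hp : p ∈ Set.Ioo (0:ℝ) 1) (hpz : p * Real.exp (-z) < 1) :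
    Summable
      (fun k : ℕ => (p * Real.exp (-z)) ^ (k + 1) / (((k : ℝ) + 2) ^ 2 - ((k : ℝ) + 2))) ∧
    Jfun p z =
      p * Real.exp (-z) *
          (-z + Real.log ((1 - p) / Real.exp 1) +
            ∑' k : ℕ, (p * Real.exp (-z)) ^ (k + 1) / (((k : ℝ) + 2) ^ 2 - ((k : ℝ) + 2)))
        - Real.log (1 - p) := by
  obtain ⟨hp0, hp1⟩ := hp
  have hx0 : 0 < p * Real.exp (-z) := by positivity
  have hsum := hasSum_pow_div_mul_pred hx0.ne' (abs_lt.mpr ⟨by linarith, hpz⟩)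
  refine ⟨hsum.summable, ?_⟩
  have h1p : 1 - p ≠ 0 := by linarith
  have h1x : 1 - p * Real.exp (-z) ≠ 0 := by linarith
  rw [hsum.tsum_eq, Jfun, mul_add (p * Real.exp (-z)), mul_div_cancel₀ _ hx0.ne',
    Real.log_div h1x h1p, Real.log_div h1p (Real.exp_ne_zero 1), Real.log_exp]
  ring
end

section
/- For every p ∈ (0,1) and every z ∈ (0, −ln(p)), the symmetry defect of the centered rate function satisfies the exact identity J(p,−z) − J(p,z) = 2·z·p·cosh(z) + 2·p·ln((1−p)/e)·sinh(z) + Σ_{k=2}^{∞} 2·p^k·sinh(k·z)/(k² − k), the series being absolutely convergent. -/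
theorem hasSum_pow_div_sq_sub_self {x : ℝ} (hx : |x| < 1) :
    HasSum (fun k : ℕ => x ^ (k + 2) / (((k : ℝ) + 2) ^ 2 - ((k : ℝ) + 2)))
      (x + (1 - x) * Real.log (1 - x)) := by
  have h := Real.hasSum_pow_div_log_of_abs_lt_one hx
  have hs := (hasSum_nat_add_iff' 1).mpr h
  have hval : x + (1 - x) * Real.log (1 - x) = x * -Real.log (1 - x) -
      (-Real.log (1 - x) - ∑ i ∈ Finset.range 1, x ^ (i + 1) / ((i : ℝ) + 1)) := by
    simp
    ring
  rw [hval]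
  refine ((h.mul_left x).sub hs).congr_fun fun k ↦ ?_
  have h1 : (k : ℝ) + 1 ≠ 0 := by positivity
  have h2 : (k : ℝ) + 2 ≠ 0 := by positivity
  have h3 : ((k : ℝ) + 2) ^ 2 - ((k : ℝ) + 2) = (k + 1) * (k + 2) := by ring
  have h4 : ((k + 1 : ℕ) : ℝ) + 1 = k + 2 := by push_cast; ring
  rw [h3, h4]
  field_simp
  ring

theorem two_mul_pow_mul_sinh (p z : ℝ) (n : ℕ) :
    2 * p ^ n * Real.sinh (n * z) =
      (p * Real.exp z) ^ n - (p * Real.exp (-z)) ^ n := by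
  rw [mul_pow, mul_pow, ← Real.exp_nat_mul, ← Real.exp_nat_mul, Real.sinh_eq, mul_neg]
  ring

theorem stmt14 (p z : ℝ) (hp : p ∈ Set.Ioo (0:ℝ) 1) (hz : z ∈ Set.Ioo 0 (-Real.log p)) :
    Summable
      (fun k : ℕ =>
        2 * p ^ (k + 2) * Real.sinh (((k : ℝ) + 2) * z) /
          (((k : ℝ) + 2) ^ 2 - ((k : ℝ) + 2))) ∧
    Jfun p (-z) - Jfun p z =
      2 * z * p * Real.cosh z + 2 * p * Real.log ((1 - p) / Real.exp 1) * Real.sinh z +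
        ∑' k : ℕ,
          2 * p ^ (k + 2) * Real.sinh (((k : ℝ) + 2) * z) /
            (((k : ℝ) + 2) ^ 2 - ((k : ℝ) + 2)) := by
  obtain ⟨hp0, hp1⟩ := hp
  obtain ⟨hz0, hz1⟩ := hz
  have ha : p * Real.exp z < 1 := by
    have h : Real.exp (Real.log p + z) < 1 := Real.exp_lt_one_iff.mpr (by linarith)
    rwa [Real.exp_add, Real.exp_log hp0] at h
  have hb : p * Real.exp (-z) < 1 :=
    (mul_lt_mul_of_pos_left (Real.exp_lt_exp.mpr (by linarith)) hp0).trans ha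
  have hsum := (hasSum_pow_div_sq_sub_self (x := p * Real.exp z)
      (by rwa [abs_of_pos (by positivity)])).sub
    (hasSum_pow_div_sq_sub_self (x := p * Real.exp (-z)) (by rwa [abs_of_pos (by positivity)]))
  have hterm : (fun k : ℕ => 2 * p ^ (k + 2) * Real.sinh (((k : ℝ) + 2) * z) /
      (((k : ℝ) + 2) ^ 2 - ((k : ℝ) + 2))) = fun k : ℕ =>
        (p * Real.exp z) ^ (k + 2) / (((k : ℝ) + 2) ^ 2 - ((k : ℝ) + 2)) -
          (p * Real.exp (-z)) ^ (k + 2) / (((k : ℝ) + 2) ^ 2 - ((k : ℝ) + 2)) := by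
    funext k
    have h := two_mul_pow_mul_sinh p z (k + 2)
    push_cast at h
    rw [h, sub_div]
  rw [hterm]
  refine ⟨hsum.summable, ?_⟩
  have hq : 1 - p ≠ 0 := by linarith
  rw [hsum.tsum_eq, Jfun, Jfun, neg_neg, Real.log_div (by linarith) hq,
    Real.log_div (by linarith) hq, Real.log_div hq (Real.exp_ne_zero 1), Real.log_exp,
    Real.cosh_eq, Real.sinh_eq]
  ring
end

section
/- For every p ∈ (0,1), the centered rate function satisfies J(p,z) ≥ 0 for all z ∈ (ln(p), ∞), with J(p,z) = 0 if and only if z = 0. -/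
theorem Real.sub_lt_mul_log_div {x y : ℝ} (hx : 0 < x) (hy : 0 < y) (hxy : x ≠ y) :
    x - y < x * Real.log (x / y) := by
  have h := Real.log_lt_sub_one_of_pos (div_pos hy hx) fun h ↦ hxy ((div_eq_one_iff_eq hx.ne').1 h).symm
  rw [← inv_div x y, Real.log_inv, inv_div] at h
  have h' := mul_lt_mul_of_pos_left h hx
  have hdiv : x * (y / x - 1) = y - x := by field_simp
  linarith

/-- `Jfun p z` is the relative entropy of Bernoulli laws with parameters `p * exp (-z)` and `p`. -/
theorem Jfun_pos {p z : ℝ} (hp : p ∈ Set.Ioo (0 : ℝ) 1) (hz : Real.log p < z) (hz0 : z ≠ 0) :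
    0 < Jfun p z := by
  obtain ⟨hp0, hp1⟩ := hp
  have hq0 : 0 < p * Real.exp (-z) := mul_pos hp0 (Real.exp_pos _)
  have hq1 : p * Real.exp (-z) < 1 := by
    rw [Real.exp_neg, ← div_eq_mul_inv, div_lt_one (Real.exp_pos z)]
    exact (Real.log_lt_iff_lt_exp hp0).1 hz
  have hne : p * Real.exp (-z) ≠ p := by
    simpa [hp0.ne'] using hz0
  have hlog : Real.log (p * Real.exp (-z) / p) = -z := by
    rw [mul_div_cancel_left₀ _ hp0.ne', Real.log_exp]
  have h₁ := Real.sub_lt_mul_log_div hq0 hp0 hne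
  have h₂ := Real.sub_lt_mul_log_div (sub_pos.2 hq1) (sub_pos.2 hp1)
    fun h ↦ hne (sub_right_injective h)
  rw [hlog] at h₁
  unfold Jfun
  linarith

theorem Jfun_zero {p : ℝ} (hp : p ≠ 1) : Jfun p 0 = 0 := by
  simp [Jfun, div_self (sub_ne_zero.2 hp.symm)]

theorem stmt16 (p : ℝ) (hp : p ∈ Set.Ioo (0:ℝ) 1) :
    ∀ z ∈ Set.Ioi (Real.log p), 0 ≤ Jfun p z ∧ (Jfun p z = 0 ↔ z = 0) := by
  intro z hz
  rcases eq_or_ne z 0 with rfl | hz0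
  · simp [Jfun_zero hp.2.ne]
  · have h := Jfun_pos hp hz hz0
    exact ⟨h.le, iff_of_false h.ne' hz0⟩
end
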